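/- Let d ≥ 1, H ∈ (0,1), α ∈ [0,1], and p ≥ 2. Let f : ℝ^d → ℝ be bounded and measurable with ‖f‖_{C^α} < ∞. Fix 0 < s ≤ u ≤ t ≤ 1, set v := c²(s,t) − c²(u,t) (which is nonnegative), and let ξ be a random vector in ℝ^d whose components are independent centered Gaussian random variables of variance v. Then there exists a constant N = N(d, α, H, p) such that for all x ∈ ℝ^d, ‖P_{c²(u,t)} f(x) − P_{c²(u,t)} f(x + ξ)‖_{L_p(Ω)} ≤ N·‖f‖_{C^α}·(u−s)^{1/2}·(t−u)^{min(Hα−1/2, 0)}. -/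

import Mathlib

open MeasureTheory ProbabilityTheory

/-- The `L_p(Ω)` norm `(E|X|^p)^{1/p}` of a random variable. -/
noncomputable def lpNorm {Ω : Type} [MeasurableSpace Ω] {F : Type*} [NormedAddCommGroup F]
    (P : Measure Ω) (p : ℝ) (X : Ω → F) : ℝ :=
  (∫ ω, ‖X ω‖ ^ p ∂P) ^ (1 / p)

/-- The Gaussian heat semigroup `P_t f = p_t * f` on `ℝ^d`. -/
noncomputable def heatP (d : ℕ) (t : ℝ) (f : EuclideanSpace ℝ (Fin d) → ℝ)
    (x : EuclideanSpace ℝ (Fin d)) : ℝ :=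
  ∫ y, (2 * Real.pi * t) ^ (-(d : ℝ) / 2) * Real.exp (-‖x - y‖ ^ 2 / (2 * t)) * f y

/-- `c²(s,t) = (2H)⁻¹ (t-s)^{2H}`. -/
noncomputable def csq (H s t : ℝ) : ℝ := (2 * H)⁻¹ * (t - s) ^ (2 * H)

lemma aux_gauss_int (d : ℕ) (b : ℝ) (hb : 0 < b) :
    Integrable (fun w : EuclideanSpace ℝ (Fin d) => Real.exp (-b * ‖w‖ ^ 2)) := by
  have h := (GaussianFourier.integrable_cexp_neg_mul_sq_norm_add
    (V := EuclideanSpace ℝ (Fin d)) (b := (b : ℂ)) (by simpa using hb) 0 0).norm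
  refine h.congr (Filter.Eventually.of_forall fun w => ?_)
  simp [Complex.norm_exp, ← Complex.ofReal_pow]

lemma aux_int_mul (d : ℕ) (g : EuclideanSpace ℝ (Fin d) → ℝ) (hg : Measurable g) (B : ℝ)
    (hB : ∀ x, |g x| ≤ B) (x : EuclideanSpace ℝ (Fin d)) :
    Integrable (fun z => Real.exp (-(1/2) * ‖x - z‖ ^ 2) * g z) := by
  have h := (aux_gauss_int d (1/2) (by norm_num)).comp_sub_left x
  exact h.mul_bdd (c := B) hg.aestronglyMeasurable (Filter.Eventually.of_forall hB)

lemma aux_holder (d : ℕ) (g : EuclideanSpace ℝ (Fin d) → ℝ) (hg : Measurable g) (B : ℝ)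
    (hB : ∀ x, |g x| ≤ B) (M α : ℝ) (hM : ∀ x y, |g x - g y| ≤ M * ‖x - y‖ ^ α)
    (x y : EuclideanSpace ℝ (Fin d)) :
    |(∫ z, Real.exp (-(1/2) * ‖x - z‖ ^ 2) * g z) - ∫ z, Real.exp (-(1/2) * ‖y - z‖ ^ 2) * g z|
      ≤ (∫ w : EuclideanSpace ℝ (Fin d), Real.exp (-(1/2) * ‖w‖ ^ 2)) * (M * ‖x - y‖ ^ α) := by
  have key : ∀ x : EuclideanSpace ℝ (Fin d), ∫ z, Real.exp (-(1/2) * ‖x - z‖ ^ 2) * g z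
      = ∫ w, Real.exp (-(1/2) * ‖w‖ ^ 2) * g (x - w) := by
    intro x
    rw [← integral_sub_left_eq_self _ volume x]
    simp
  have hgi : ∀ x : EuclideanSpace ℝ (Fin d),
      Integrable (fun w => Real.exp (-(1/2) * ‖w‖ ^ 2) * g (x - w)) := by
    intro x
    refine (aux_gauss_int d (1/2) (by norm_num)).mul_bdd (c := B) ?_
      (Filter.Eventually.of_forall fun w => hB _)
    exact (hg.comp (measurable_const.sub measurable_id)).aestronglyMeasurable
  rw [key, key, ← integral_sub (hgi x) (hgi y), ← integral_mul_const]
  refine (norm_integral_le_integral_norm (G := ℝ) _).trans ?_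
  refine integral_mono_of_nonneg (Filter.Eventually.of_forall fun _ => norm_nonneg _)
    ((aux_gauss_int d (1/2) (by norm_num)).mul_const _)
    (Filter.Eventually.of_forall fun w => ?_)
  simp only [← mul_sub, norm_mul, Real.norm_eq_abs, Real.abs_exp]
  have := hM (x - w) (y - w)
  rw [sub_sub_sub_cancel_right] at this
  gcongr

lemma aux_exp_sub (A B : ℝ) (m : ℝ) (hA : m ≤ A) (hB : m ≤ B) :
    |Real.exp (-A) - Real.exp (-B)| ≤ |A - B| * Real.exp (-m) := by
  wlog h : A ≤ B generalizing A B
  · rw [abs_sub_comm, abs_sub_comm A]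
    exact this B A hB hA (le_of_not_ge h)
  have h1 : Real.exp (-B) = Real.exp (-A) * Real.exp (-(B - A)) := by
    rw [← Real.exp_add]; ring_nf
  have h2 : 1 - (B - A) ≤ Real.exp (-(B - A)) := by
    have := Real.add_one_le_exp (-(B - A)); linarith
  have h3 : Real.exp (-B) ≤ Real.exp (-A) := Real.exp_le_exp.2 (by linarith)
  have h4 : Real.exp (-A) ≤ Real.exp (-m) := Real.exp_le_exp.2 (by linarith)
  rw [abs_of_nonneg (by linarith), abs_of_nonpos (by linarith), h1]
  have := Real.exp_pos (-A)
  nlinarith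

lemma aux_pt {E : Type*} [NormedAddCommGroup E] (w h : E) (hh : ‖h‖ ≤ 1)
    (α : ℝ) (h0 : 0 ≤ α) (h1 : α ≤ 1) :
    |Real.exp (-(1/2) * ‖w‖ ^ 2) - Real.exp (-(1/2) * ‖w + h‖ ^ 2)| * ‖w‖ ^ α
      ≤ ‖h‖ * (16 * Real.exp (1/2) * Real.exp (-(1/8) * ‖w‖ ^ 2)) := by
  set r := ‖w‖
  set q := ‖w + h‖
  set e := ‖h‖
  have hr : 0 ≤ r := norm_nonneg _
  have hq : 0 ≤ q := norm_nonneg _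
  have he : 0 ≤ e := norm_nonneg _
  have a1 : q ≤ r + e := norm_add_le _ _
  have a2 : r ≤ q + e := by
    have := norm_sub_le (w + h) h
    simpa using this
  have hm : |Real.exp (-(1/2 * r ^ 2)) - Real.exp (-(1/2 * q ^ 2))|
      ≤ |1/2 * r^2 - 1/2 * q^2| * Real.exp (-(r^2/4 - 1/2)) := by
    apply aux_exp_sub
    · nlinarith
    · nlinarith [sq_nonneg (q - e)]
  have hd : |1/2 * r^2 - 1/2 * q^2| ≤ e * (r + 1) := by
    rw [abs_le]; constructor <;> nlinarith
  have hra : r ^ α ≤ r + 1 := by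
    rcases le_total r 1 with h | h
    · have := Real.rpow_le_one hr h h0; linarith
    · have := Real.rpow_le_rpow_of_exponent_le h h1
      rw [Real.rpow_one] at this; linarith
  have hsq : (r + 1) ^ 2 ≤ 16 * Real.exp (r^2/8) := by
    have := Real.add_one_le_exp (r^2/8)
    nlinarith [sq_nonneg (r - 1)]
  have hee : Real.exp (-(r^2/4 - 1/2)) * Real.exp (r^2/8)
      = Real.exp (1/2) * Real.exp (-(1/8) * r ^ 2) := by
    rw [← Real.exp_add, ← Real.exp_add]; ring_nf
  simp only [neg_mul]
  calc _ ≤ (e * (r + 1) * Real.exp (-(r^2/4 - 1/2))) * (r + 1) := by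
        gcongr
        exact hm.trans (by gcongr)
    _ = e * (Real.exp (-(r^2/4 - 1/2)) * (r + 1)^2) := by ring
    _ ≤ e * (Real.exp (-(r^2/4 - 1/2)) * (16 * Real.exp (r^2/8))) := by gcongr
    _ = e * (16 * (Real.exp (-(r^2/4 - 1/2)) * Real.exp (r^2/8))) := by ring
    _ = _ := by rw [hee]; ring_nf

lemma aux_grad (d : ℕ) (g : EuclideanSpace ℝ (Fin d) → ℝ) (hg : Measurable g) (B : ℝ)
    (hB : ∀ x, |g x| ≤ B) (M α : ℝ) (hM0 : 0 ≤ M) (h0 : 0 ≤ α) (h1 : α ≤ 1)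
    (hM : ∀ x y, |g x - g y| ≤ M * ‖x - y‖ ^ α)
    (x y : EuclideanSpace ℝ (Fin d)) (hxy : ‖x - y‖ ≤ 1) :
    |(∫ z, Real.exp (-(1/2) * ‖x - z‖ ^ 2) * g z) - ∫ z, Real.exp (-(1/2) * ‖y - z‖ ^ 2) * g z|
      ≤ (∫ w : EuclideanSpace ℝ (Fin d), 16 * Real.exp (1/2) * Real.exp (-(1/8) * ‖w‖ ^ 2))
        * (M * ‖x - y‖) := by
  have hB' : ∀ z, |g z - g x| ≤ B + B := fun z =>
    (abs_sub _ _).trans (add_le_add (hB z) (hB x))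
  have hgm : Measurable (fun z => g z - g x) := hg.sub_const _
  have i1 := aux_int_mul d _ hgm _ hB' x
  have i2 := aux_int_mul d _ hgm _ hB' y
  have hk : ∀ x : EuclideanSpace ℝ (Fin d),
      Integrable (fun z => Real.exp (-(1/2) * ‖x - z‖ ^ 2)) := fun x =>
    (aux_gauss_int d (1/2) (by norm_num)).comp_sub_left x
  have hki : ∀ x : EuclideanSpace ℝ (Fin d), ∫ z, Real.exp (-(1/2) * ‖x - z‖ ^ 2)
      = ∫ z : EuclideanSpace ℝ (Fin d), Real.exp (-(1/2) * ‖z‖ ^ 2) := fun x =>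
    integral_sub_left_eq_self (fun z : EuclideanSpace ℝ (Fin d) =>
      Real.exp (-(1/2) * ‖z‖ ^ 2)) volume x
  have e : ∀ y : EuclideanSpace ℝ (Fin d),
      ∫ z, Real.exp (-(1/2) * ‖y - z‖ ^ 2) * (g z - g x)
      = (∫ z, Real.exp (-(1/2) * ‖y - z‖ ^ 2) * g z)
        - (∫ z : EuclideanSpace ℝ (Fin d), Real.exp (-(1/2) * ‖z‖ ^ 2)) * g x := by
    intro y
    simp only [mul_sub]
    rw [integral_sub (aux_int_mul d g hg B hB y) ((hk y).mul_const _), integral_mul_const, hki]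
  have e2 : (∫ z, Real.exp (-(1/2) * ‖x - z‖ ^ 2) * g z)
      - (∫ z, Real.exp (-(1/2) * ‖y - z‖ ^ 2) * g z)
      = ∫ z, (Real.exp (-(1/2) * ‖x - z‖ ^ 2) * (g z - g x)
        - Real.exp (-(1/2) * ‖y - z‖ ^ 2) * (g z - g x)) := by
    rw [integral_sub i1 i2, e, e]; ring
  rw [e2, ← integral_mul_const, ← integral_sub_left_eq_self
    (fun w : EuclideanSpace ℝ (Fin d) =>
      16 * Real.exp (1/2) * Real.exp (-(1/8) * ‖w‖ ^ 2) * (M * ‖x - y‖)) volume x]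
  refine (norm_integral_le_integral_norm (G := ℝ) _).trans ?_
  refine integral_mono_of_nonneg (Filter.Eventually.of_forall fun _ => norm_nonneg _)
    ((((aux_gauss_int d (1/8) (by norm_num)).const_mul _).mul_const _).comp_sub_left x)
    (Filter.Eventually.of_forall fun z => ?_)
  simp only [← sub_mul, norm_mul, Real.norm_eq_abs]
  have p1 := aux_pt (x - z) (y - x) (by rwa [norm_sub_rev]) α h0 h1
  rw [show x - z + (y - x) = y - z by abel, norm_sub_rev y x] at p1
  have p2 := hM z x
  rw [norm_sub_rev z x] at p2
  calc _ ≤ |Real.exp (-(1/2) * ‖x - z‖ ^ 2) - Real.exp (-(1/2) * ‖y - z‖ ^ 2)|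
        * (M * ‖x - z‖ ^ α) := by gcongr
    _ = M * (|Real.exp (-(1/2) * ‖x - z‖ ^ 2) - Real.exp (-(1/2) * ‖y - z‖ ^ 2)|
        * ‖x - z‖ ^ α) := by ring
    _ ≤ _ := mul_le_mul_of_nonneg_left p1 hM0
    _ = _ := by ring

lemma aux_unit (d : ℕ) : ∃ K : ℝ, 0 < K ∧ ∀ (g : EuclideanSpace ℝ (Fin d) → ℝ) (B M α : ℝ),
    Measurable g → (∀ x, |g x| ≤ B) → 0 ≤ M → 0 ≤ α → α ≤ 1 →
    (∀ x y, |g x - g y| ≤ M * ‖x - y‖ ^ α) → ∀ x y : EuclideanSpace ℝ (Fin d),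
    |(∫ z, Real.exp (-(1/2) * ‖x - z‖ ^ 2) * g z) - ∫ z, Real.exp (-(1/2) * ‖y - z‖ ^ 2) * g z|
      ≤ K * (M * ‖x - y‖ ^ α) ∧
    |(∫ z, Real.exp (-(1/2) * ‖x - z‖ ^ 2) * g z) - ∫ z, Real.exp (-(1/2) * ‖y - z‖ ^ 2) * g z|
      ≤ K * (M * ‖x - y‖) := by
  set K1 := (∫ w : EuclideanSpace ℝ (Fin d), Real.exp (-(1/2) * ‖w‖ ^ 2))
  set K2 := (∫ w : EuclideanSpace ℝ (Fin d), 16 * Real.exp (1/2) * Real.exp (-(1/8) * ‖w‖ ^ 2))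
  have hK1 : 0 ≤ K1 := integral_nonneg fun _ => by positivity
  have hK2 : 0 ≤ K2 := integral_nonneg fun _ => by positivity
  refine ⟨K1 + K2 + 1, by positivity, ?_⟩
  intro g B M α hg hB hM0 h0 h1 hM x y
  have hA := aux_holder d g hg B hB M α hM x y
  have hA1 : K1 * (M * ‖x - y‖ ^ α) ≤ (K1 + K2 + 1) * (M * ‖x - y‖ ^ α) := by
    gcongr; linarith
  refine ⟨hA.trans hA1, ?_⟩
  rcases le_total ‖x - y‖ 1 with h | h
  · refine (aux_grad d g hg B hB M α hM0 h0 h1 hM x y h).trans ?_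
    gcongr
    change K2 ≤ _
    linarith
  · refine hA.trans (hA1.trans ?_)
    gcongr
    simpa using Real.rpow_le_rpow_of_exponent_le h h1

lemma aux_scale (d : ℕ) (c : ℝ) (hc : 0 < c) (f : EuclideanSpace ℝ (Fin d) → ℝ)
    (x : EuclideanSpace ℝ (Fin d)) :
    heatP d c f x = (2 * Real.pi) ^ (-(d : ℝ) / 2) *
      ∫ z, Real.exp (-(1/2) * ‖(√c)⁻¹ • x - z‖ ^ 2) * f (√c • z) := by
  have hs : 0 < √c := Real.sqrt_pos.2 hc
  have h := Measure.integral_comp_smul (volume : Measure (EuclideanSpace ℝ (Fin d)))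
    (fun y => (2 * Real.pi * c) ^ (-(d : ℝ) / 2) * Real.exp (-‖x - y‖ ^ 2 / (2 * c)) * f y) (√c)
  have h2 : heatP d c f x = √c ^ d * ∫ z, (2 * Real.pi * c) ^ (-(d : ℝ) / 2) *
      Real.exp (-‖x - √c • z‖ ^ 2 / (2 * c)) * f (√c • z) := by
    rw [h, heatP]
    simp only [finrank_euclideanSpace, Fintype.card_fin, smul_eq_mul]
    rw [abs_of_pos (by positivity)]
    field_simp
  rw [h2, ← integral_const_mul, ← integral_const_mul]
  congr 1
  ext z
  have e1 : x - √c • z = √c • ((√c)⁻¹ • x - z) := by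
    rw [smul_sub, smul_smul, mul_inv_cancel₀ hs.ne', one_smul]
  have e2 : √c ^ d * (2 * Real.pi * c) ^ (-(d : ℝ) / 2) = (2 * Real.pi) ^ (-(d : ℝ) / 2) := by
    rw [Real.mul_rpow (by positivity) hc.le, Real.sqrt_eq_rpow, ← Real.rpow_natCast,
      ← Real.rpow_mul hc.le, mul_left_comm, ← Real.rpow_add hc]
    ring_nf
    simp
  have e3 : -‖x - √c • z‖ ^ 2 / (2 * c) = -(1/2) * ‖(√c)⁻¹ • x - z‖ ^ 2 := by
    rw [e1, norm_smul, mul_pow, Real.norm_eq_abs, sq_abs, Real.sq_sqrt hc.le]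
    field_simp
  rw [e3, ← e2]; ring

lemma aux_heat (d : ℕ) : ∃ K : ℝ, 0 < K ∧ ∀ (f : EuclideanSpace ℝ (Fin d) → ℝ) (B M α c : ℝ),
    Measurable f → (∀ x, |f x| ≤ B) → 0 ≤ M → 0 ≤ α → α ≤ 1 → 0 < c →
    (∀ x y, |f x - f y| ≤ M * ‖x - y‖ ^ α) → ∀ x y : EuclideanSpace ℝ (Fin d),
    |heatP d c f x - heatP d c f y| ≤ K * M * ‖x - y‖ ^ α ∧
    |heatP d c f x - heatP d c f y| ≤ K * M * c ^ ((α - 1)/2) * ‖x - y‖ := by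
  obtain ⟨K, hK, h⟩ := aux_unit d
  refine ⟨(2 * Real.pi) ^ (-(d : ℝ) / 2) * K, by positivity, ?_⟩
  intro f B M α c hf hB hM0 h0 h1 hc hM x y
  have hs : 0 < √c := Real.sqrt_pos.2 hc
  have := h (fun z => f (√c • z)) B (M * √c ^ α) α (hf.comp (measurable_const_smul _))
    (fun _ => hB _) (by positivity) h0 h1 (by
      intro x y
      refine (hM _ _).trans (le_of_eq ?_)
      rw [← smul_sub, norm_smul, Real.mul_rpow (norm_nonneg _) (norm_nonneg _), Real.norm_eq_abs,
        abs_of_pos hs]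
      ring) ((√c)⁻¹ • x) ((√c)⁻¹ • y)
  rw [← smul_sub, norm_smul, Real.mul_rpow (norm_nonneg _) (norm_nonneg _), Real.norm_eq_abs,
    abs_of_pos (inv_pos.2 hs)] at this
  have e1 : M * √c ^ α * ((√c)⁻¹ ^ α * ‖x - y‖ ^ α) = M * ‖x - y‖ ^ α := by
    rw [Real.inv_rpow hs.le]
    have : √c ^ α ≠ 0 := by positivity
    field_simp
  have e2 : M * √c ^ α * ((√c)⁻¹ * ‖x - y‖) = M * c ^ ((α - 1)/2) * ‖x - y‖ := by
    have : √c ^ α * (√c)⁻¹ = c ^ ((α - 1)/2) := by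
      rw [← Real.rpow_neg_one, ← Real.rpow_add hs, Real.sqrt_eq_rpow, ← Real.rpow_mul hc.le]
      ring_nf
    rw [← this]; ring
  rw [e1, e2] at this
  rw [aux_scale d c hc, aux_scale d c hc, ← mul_sub, abs_mul, abs_of_pos (by positivity)]
  constructor
  · calc _ ≤ _ := mul_le_mul_of_nonneg_left this.1 (by positivity)
      _ = _ := by ring
  · calc _ ≤ _ := mul_le_mul_of_nonneg_left this.2 (by positivity)
      _ = _ := by ring

lemma aux_moment (d : ℕ) (q : ℝ) (hq : 0 ≤ q) :
    Integrable (fun z : EuclideanSpace ℝ (Fin d) => ‖z‖ ^ q)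
      (stdGaussian (EuclideanSpace ℝ (Fin d))) := by
  rcases hq.eq_or_lt with rfl | hq
  · simp
  have h := (IsGaussian.memLp_id (stdGaussian (EuclideanSpace ℝ (Fin d))) (ENNReal.ofReal q)
    ENNReal.ofReal_ne_top).integrable_norm_rpow (by simpa using hq) ENNReal.ofReal_ne_top
  simpa [ENNReal.toReal_ofReal hq.le] using h

lemma aux_law (d : ℕ) (v : ℝ) (hv : 0 ≤ v) (Ω : Type) [MeasurableSpace Ω] (P : Measure Ω)
    (ξ : Ω → EuclideanSpace ℝ (Fin d))
    (h : Measure.map (fun ω => fun i => ξ ω i) P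
        = Measure.pi (fun _ : Fin d => gaussianReal 0 (Real.toNNReal v))) :
    AEMeasurable ξ P ∧ Measure.map ξ P =
      Measure.map (fun z => √v • z) (stdGaussian (EuclideanSpace ℝ (Fin d))) := by
  have hm : AEMeasurable (fun ω => fun i => ξ ω i) P := by
    by_contra hn
    rw [Measure.map_of_not_aemeasurable hn] at h
    exact (IsProbabilityMeasure.ne_zero _) h.symm
  have hto : Measurable (WithLp.toLp 2 : (Fin d → ℝ) → EuclideanSpace ℝ (Fin d)) := by fun_prop
  have hξ : ξ = (WithLp.toLp 2 : (Fin d → ℝ) → EuclideanSpace ℝ (Fin d)) ∘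
      (fun ω => fun i => ξ ω i) := by
    ext ω i; simp
  have hme : AEMeasurable ξ P := by rw [hξ]; exact hto.comp_aemeasurable hm
  refine ⟨hme, ?_⟩
  have hg : gaussianReal 0 (Real.toNNReal v) = (gaussianReal 0 1).map (fun x => √v * x) := by
    rw [gaussianReal_map_const_mul]
    congr 1
    · simp
    · ext; simp [Real.sq_sqrt hv, hv]
  have hpi : Measure.pi (fun _ : Fin d => gaussianReal 0 (Real.toNNReal v))
      = (Measure.pi (fun _ : Fin d => gaussianReal 0 1)).map (fun z i => √v * z i) := by
    have : ∀ i : Fin d, SigmaFinite ((gaussianReal 0 1).map (fun x => √v * x)) := by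
      intro i; rw [← hg]; infer_instance
    rw [Measure.pi_map_pi (f := fun _ x => √v * x) (fun i => by fun_prop)]
    simp_rw [hg]
  have hsm : Measurable (fun z : EuclideanSpace ℝ (Fin d) => √v • z) := measurable_const_smul _
  have hsm2 : Measurable (fun (z : Fin d → ℝ) i => √v * z i) := by fun_prop
  have h1 : Measure.map ξ P = Measure.map (WithLp.toLp 2 : (Fin d → ℝ) → EuclideanSpace ℝ (Fin d))
      (Measure.map (fun ω => fun i => ξ ω i) P) := by
    rw [AEMeasurable.map_map_of_aemeasurable hto.aemeasurable hm, ← hξ]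
  rw [h1, h, hpi, ← map_pi_eq_stdGaussian, Measure.map_map hto hsm2, Measure.map_map hsm hto]
  rfl

lemma aux_lp (d : ℕ) (v : ℝ) (hv : 0 ≤ v) (Ω : Type) [MeasurableSpace Ω] (P : Measure Ω)
    (ξ : Ω → EuclideanSpace ℝ (Fin d))
    (h : Measure.map (fun ω => fun i => ξ ω i) P
        = Measure.pi (fun _ : Fin d => gaussianReal 0 (Real.toNNReal v)))
    (p β A : ℝ) (hp : 2 ≤ p) (hβ : 0 ≤ β) (hA : 0 ≤ A) (X : Ω → ℝ)
    (hX : ∀ ω, |X ω| ≤ A * ‖ξ ω‖ ^ β) :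
    lpNorm P p X ≤ A * v ^ (β/2) *
      (∫ z, ‖z‖ ^ (β * p) ∂(stdGaussian (EuclideanSpace ℝ (Fin d)))) ^ (1/p) := by
  obtain ⟨hm, hl⟩ := aux_law d v hv Ω P ξ h
  have hp0 : 0 < p := by linarith
  have hbp : 0 ≤ β * p := by positivity
  have hnm : Measurable (fun z : EuclideanSpace ℝ (Fin d) => ‖z‖ ^ (β * p)) := by fun_prop
  have hsm : Measurable (fun z : EuclideanSpace ℝ (Fin d) => √v • z) := measurable_const_smul _
  have heq : (fun z : EuclideanSpace ℝ (Fin d) => ‖√v • z‖ ^ (β * p))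
      = fun z => √v ^ (β * p) * ‖z‖ ^ (β * p) := by
    ext z
    rw [norm_smul, Real.mul_rpow (norm_nonneg _) (norm_nonneg _), Real.norm_eq_abs,
      abs_of_nonneg (Real.sqrt_nonneg v)]
  have hi : Integrable (fun ω => ‖ξ ω‖ ^ (β * p)) P := by
    have : Integrable (fun z : EuclideanSpace ℝ (Fin d) => ‖z‖ ^ (β * p)) (Measure.map ξ P) := by
      rw [hl, integrable_map_measure hnm.aestronglyMeasurable hsm.aemeasurable]
      change Integrable (fun z : EuclideanSpace ℝ (Fin d) => ‖√v • z‖ ^ (β * p)) _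
      rw [heq]
      exact (aux_moment d _ hbp).const_mul _
    exact (integrable_map_measure hnm.aestronglyMeasurable hm).1 this
  have hv2 : ∫ ω, ‖ξ ω‖ ^ (β * p) ∂P = √v ^ (β * p) *
      ∫ z, ‖z‖ ^ (β * p) ∂(stdGaussian (EuclideanSpace ℝ (Fin d))) := by
    rw [← integral_map (f := fun z : EuclideanSpace ℝ (Fin d) => ‖z‖ ^ (β * p)) hm
      hnm.aestronglyMeasurable, hl, integral_map hsm.aemeasurable hnm.aestronglyMeasurable, heq,
      integral_const_mul]
  have hmono : ∫ ω, ‖X ω‖ ^ p ∂P ≤ ∫ ω, A ^ p * ‖ξ ω‖ ^ (β * p) ∂P := by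
    refine integral_mono_of_nonneg (Filter.Eventually.of_forall fun _ => by positivity)
      (hi.const_mul _) (Filter.Eventually.of_forall fun ω => ?_)
    have := Real.rpow_le_rpow (abs_nonneg _) (hX ω) hp0.le
    rwa [Real.mul_rpow hA (by positivity), ← Real.rpow_mul (norm_nonneg _)] at this
  have hM : 0 ≤ ∫ z, ‖z‖ ^ (β * p) ∂(stdGaussian (EuclideanSpace ℝ (Fin d))) :=
    integral_nonneg fun _ => by positivity
  rw [integral_const_mul, hv2] at hmono
  unfold _root_.lpNorm
  refine (Real.rpow_le_rpow (integral_nonneg fun _ => by positivity) hmono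
    (by positivity)).trans (le_of_eq ?_)
  rw [Real.mul_rpow (by positivity) (by positivity), Real.mul_rpow (by positivity) hM,
    ← Real.rpow_mul hA, ← Real.rpow_mul (Real.sqrt_nonneg v), mul_one_div_cancel hp0.ne',
    Real.rpow_one, Real.sqrt_eq_rpow, ← Real.rpow_mul hv, ← mul_assoc]
  congr 3
  field_simp

lemma aux_var1 (H a b : ℝ) (hH0 : 0 < H) (hH1 : H < 1) (ha : 0 < a) (hb : 0 ≤ b) (hab : b ≤ a) :
    (2 * H)⁻¹ * (a + b) ^ (2 * H) - (2 * H)⁻¹ * a ^ (2 * H)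
      ≤ 3 * (2 * H)⁻¹ * (a ^ (2 * H - 1) * b) := by
  have hr : 0 ≤ b / a := by positivity
  have hr1 : b / a ≤ 1 := (div_le_one ha).2 hab
  have e1 : (a + b) ^ (2 * H) = a ^ (2 * H) * (1 + b / a) ^ (2 * H) := by
    rw [← Real.mul_rpow ha.le (by positivity)]
    congr 1
    field_simp
  have e2 : (1 + b / a) ^ (2 * H) ≤ 1 + 3 * (b / a) := by
    calc (1 + b / a) ^ (2 * H) ≤ (1 + b / a) ^ (2 : ℝ) :=
          Real.rpow_le_rpow_of_exponent_le (by linarith) (by linarith)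
      _ = (1 + b / a) ^ 2 := by norm_cast
      _ ≤ _ := by nlinarith
  have e3 : a ^ (2 * H - 1) * b = a ^ (2 * H) * (b / a) := by
    rw [Real.rpow_sub_one ha.ne']; ring
  rw [e1, e3]
  have : 0 < (2 * H)⁻¹ * a ^ (2 * H) := by positivity
  nlinarith

lemma aux_var2 (H a b : ℝ) (hH0 : 0 < H) (hH1 : H < 1) (ha : 0 < a) (hab : a ≤ b) :
    (2 * H)⁻¹ * (a + b) ^ (2 * H) - (2 * H)⁻¹ * a ^ (2 * H)
      ≤ 4 * (2 * H)⁻¹ * b ^ (2 * H) := by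
  have hb : 0 < b := by linarith
  have e1 : (a + b) ^ (2 * H) ≤ 4 * b ^ (2 * H) := by
    calc (a + b) ^ (2 * H) ≤ (2 * b) ^ (2 * H) := by gcongr; linarith
      _ = 2 ^ (2 * H) * b ^ (2 * H) := Real.mul_rpow (by norm_num) hb.le
      _ ≤ 2 ^ (2 : ℝ) * b ^ (2 * H) := by gcongr <;> linarith
      _ = _ := by norm_num
  have h1 : 0 < (2 * H)⁻¹ := by positivity
  have : 0 < (2 * H)⁻¹ * a ^ (2 * H) := by positivity
  nlinarith

/-- Heat-kernel bound, Proposition 3.7(iv): for `H ∈ (0,1)`, `α ∈ [0,1]`, `p ≥ 2`,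
bounded measurable `f` of class `C^α`, `0 < s ≤ u ≤ t ≤ 1`, and a random vector
`ξ` with independent `N(0, v)` components where `v = c²(s,t) - c²(u,t)`,
`‖P_{c²(u,t)} f(x) - P_{c²(u,t)} f(x+ξ)‖_{L_p(Ω)}
   ≤ N ‖f‖_{C^α} (u-s)^{1/2} (t-u)^{min(Hα-1/2, 0)}` for all `x`,
with `N = N(d,α,H,p)`. `Cf` is any admissible value of `‖f‖_{C^α}`
(for `α = 0` only boundedness is required). -/
theorem stmt_10 (d : ℕ) (hd : 1 ≤ d) (H α p : ℝ)
    (hH0 : 0 < H) (hH1 : H < 1) (hα0 : 0 ≤ α) (hα1 : α ≤ 1) (hp : 2 ≤ p) :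
    ∃ N : ℝ, 0 < N ∧
      ∀ (f : EuclideanSpace ℝ (Fin d) → ℝ) (Cf : ℝ), Measurable f → 0 ≤ Cf →
      (∀ x, |f x| ≤ Cf) →
      (α ≠ 0 → ∀ x y, |f x - f y| ≤ Cf * ‖x - y‖ ^ α) →
      ∀ s u t : ℝ, 0 < s → s ≤ u → u ≤ t → t ≤ 1 →
      ∀ (Ω : Type) [m0 : MeasurableSpace Ω] (P : Measure Ω), IsProbabilityMeasure P →
      ∀ ξ : Ω → EuclideanSpace ℝ (Fin d),
      Measure.map (fun ω => fun i => ξ ω i) P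
        = Measure.pi (fun _ : Fin d =>
            gaussianReal 0 (Real.toNNReal (csq H s t - csq H u t))) →
      ∀ x : EuclideanSpace ℝ (Fin d),
        lpNorm P p (fun ω => heatP d (csq H u t) f x - heatP d (csq H u t) f (x + ξ ω))
          ≤ N * Cf * (u - s) ^ ((1 : ℝ)/2) * (t - u) ^ (min (H*α - 1/2) 0) := by
  obtain ⟨K, hK, hheat⟩ := aux_heat d
  set m1 := (∫ z, ‖z‖ ^ (1 * p) ∂(stdGaussian (EuclideanSpace ℝ (Fin d)))) ^ (1/p) with hm1
  set m2 := (∫ z, ‖z‖ ^ (α * p) ∂(stdGaussian (EuclideanSpace ℝ (Fin d)))) ^ (1/p) with hm2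
  have hm1' : 0 ≤ m1 := Real.rpow_nonneg (integral_nonneg fun _ => by positivity) _
  have hm2' : 0 ≤ m2 := Real.rpow_nonneg (integral_nonneg fun _ => by positivity) _
  set N1 := K * 2 * ((2 * H)⁻¹) ^ ((α - 1)/2) * (3 * (2 * H)⁻¹) ^ ((1:ℝ)/2) * m1 with hN1
  set N2 := K * 2 * (4 * (2 * H)⁻¹) ^ (α/2) * m2 with hN2
  have hN1' : 0 ≤ N1 := by positivity
  have hN2' : 0 ≤ N2 := by positivity
  refine ⟨N1 + N2 + 1, by positivity, ?_⟩
  intro f Cf hf hCf hB hHol s u t hs hsu hut ht Ω _ P hP ξ hξ x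
  have ha0 : 0 ≤ t - u := by linarith
  have hb0 : 0 ≤ u - s := by linarith
  have hR : 0 ≤ Cf * (u - s) ^ ((1 : ℝ)/2) * (t - u) ^ (min (H*α - 1/2) 0) := by positivity
  have hfin : ∀ N', N' ≤ N1 + N2 + 1 →
      N' * (Cf * (u - s) ^ ((1 : ℝ)/2) * (t - u) ^ (min (H*α - 1/2) 0))
      ≤ (N1 + N2 + 1) * Cf * (u - s) ^ ((1 : ℝ)/2) * (t - u) ^ (min (H*α - 1/2) 0) := by
    intro N' h
    calc _ ≤ (N1 + N2 + 1) * (Cf * (u - s) ^ ((1 : ℝ)/2) * (t - u) ^ (min (H*α - 1/2) 0)) := by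
          gcongr
      _ = _ := by ring
  have hM : ∀ x y, |f x - f y| ≤ (2 * Cf) * ‖x - y‖ ^ α := by
    intro x y
    by_cases h : α = 0
    · rw [h, Real.rpow_zero]
      have h1 := hB x
      have h2 := hB y
      have := abs_sub (f x) (f y)
      linarith
    · refine (hHol h x y).trans ?_
      gcongr
      linarith
  rcases ha0.eq_or_lt with ha | ha
  · refine le_trans (le_of_eq ?_) (hfin 0 (by positivity))
    have hc : csq H u t = 0 := by
      rw [csq, ← ha, Real.zero_rpow (by positivity), mul_zero]
    have hd' : (-(d : ℝ) / 2) ≠ 0 := by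
      have : (0 : ℝ) < d := by exact_mod_cast hd
      have : -(d : ℝ) / 2 < 0 := by linarith
      exact this.ne
    have hz : ∀ y, heatP d (csq H u t) f y = 0 := by
      intro y
      rw [hc, heatP]
      simp [Real.zero_rpow hd']
    unfold _root_.lpNorm
    simp only [hz, sub_zero, norm_zero]
    rw [Real.zero_rpow (by linarith), integral_zero, Real.zero_rpow (by positivity), zero_mul]
  set a := t - u with hadef
  set b := u - s with hbdef
  have hab1 : a + b ≤ 1 := by rw [hadef, hbdef]; linarith
  have hts : t - s = a + b := by rw [hadef, hbdef]; ring
  set c := csq H u t with hcdef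
  have hc : c = (2 * H)⁻¹ * a ^ (2 * H) := rfl
  have hcpos : 0 < c := by rw [hc]; positivity
  set v := csq H s t - c with hvdef
  have hv : v = (2 * H)⁻¹ * (a + b) ^ (2 * H) - (2 * H)⁻¹ * a ^ (2 * H) := by
    rw [hvdef, hc, csq, hts]
  have hv0 : 0 ≤ v := by
    rw [hv, sub_nonneg]
    gcongr
    linarith
  have hX := fun ω => hheat f Cf (2 * Cf) α c hf hB (by positivity) hα0 hα1 hcpos hM x (x + ξ ω)
  simp only [sub_add_cancel_left, norm_neg] at hX
  rcases le_total b a with hba | hba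
  · refine le_trans ?_ (hfin N1 (by linarith))
    refine (aux_lp d v hv0 Ω P ξ hξ p 1 (K * (2 * Cf) * c ^ ((α - 1)/2)) hp zero_le_one
      (by positivity) _ (fun ω => by rw [Real.rpow_one]; exact (hX ω).2)).trans ?_
    rw [← hm1]
    have hve : v ^ ((1:ℝ)/2) ≤ (3 * (2 * H)⁻¹) ^ ((1:ℝ)/2) * (a ^ (H - 1/2) * b ^ ((1:ℝ)/2)) := by
      calc v ^ ((1:ℝ)/2) ≤ (3 * (2 * H)⁻¹ * (a ^ (2 * H - 1) * b)) ^ ((1:ℝ)/2) := by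
            gcongr
            rw [hv]; exact aux_var1 H a b hH0 hH1 ha hb0 hba
        _ = _ := by
            rw [Real.mul_rpow (by positivity) (by positivity), Real.mul_rpow (by positivity) hb0,
              ← Real.rpow_mul ha.le]
            ring_nf
    have hce : c ^ ((α - 1)/2) = ((2 * H)⁻¹) ^ ((α - 1)/2) * a ^ (H * α - H) := by
      rw [hc, Real.mul_rpow (by positivity) (by positivity), ← Real.rpow_mul ha.le]
      ring_nf
    have hae : a ^ (H * α - H) * a ^ (H - 1/2) ≤ a ^ (min (H*α - 1/2) 0) := by
      rw [← Real.rpow_add ha]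
      apply Real.rpow_le_rpow_of_exponent_ge ha (by linarith)
      refine (min_le_left _ _).trans (le_of_eq (by ring))
    calc K * (2 * Cf) * c ^ ((α - 1)/2) * v ^ ((1:ℝ)/2) * m1
        ≤ K * (2 * Cf) * (((2 * H)⁻¹) ^ ((α - 1)/2) * a ^ (H * α - H)) *
          ((3 * (2 * H)⁻¹) ^ ((1:ℝ)/2) * (a ^ (H - 1/2) * b ^ ((1:ℝ)/2))) * m1 := by
          rw [hce]; gcongr
      _ = N1 * (Cf * b ^ ((1:ℝ)/2) * (a ^ (H * α - H) * a ^ (H - 1/2))) := by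
          rw [hN1]; ring
      _ ≤ _ := by gcongr
  · refine le_trans ?_ (hfin N2 (by linarith))
    have hbpos : 0 < b := by linarith
    refine (aux_lp d v hv0 Ω P ξ hξ p α (K * (2 * Cf)) hp hα0
      (by positivity) _ (fun ω => (hX ω).1)).trans ?_
    rw [← hm2]
    have hve : v ^ (α/2) ≤ (4 * (2 * H)⁻¹) ^ (α/2) * b ^ (H * α) := by
      calc v ^ (α/2) ≤ (4 * (2 * H)⁻¹ * b ^ (2 * H)) ^ (α/2) := by
            gcongr
            rw [hv]; exact aux_var2 H a b hH0 hH1 ha hba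
        _ = _ := by
            rw [Real.mul_rpow (by positivity) (by positivity), ← Real.rpow_mul hb0]
            ring_nf
    have hbe : b ^ (H * α) ≤ b ^ ((1:ℝ)/2) * a ^ (min (H*α - 1/2) 0) := by
      calc b ^ (H * α) = b ^ ((1:ℝ)/2) * b ^ (H * α - 1/2) := by
            rw [← Real.rpow_add hbpos]; ring_nf
        _ ≤ b ^ ((1:ℝ)/2) * b ^ (min (H*α - 1/2) 0) := by
            gcongr ?_ * ?_
            exact Real.rpow_le_rpow_of_exponent_ge hbpos (by linarith) (min_le_left _ _)
        _ ≤ _ := by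
            gcongr ?_ * ?_
            exact Real.rpow_le_rpow_of_nonpos ha hba (min_le_right _ _)
    calc K * (2 * Cf) * v ^ (α/2) * m2
        ≤ K * (2 * Cf) * ((4 * (2 * H)⁻¹) ^ (α/2) *
          (b ^ ((1:ℝ)/2) * a ^ (min (H*α - 1/2) 0))) * m2 := by
          gcongr
          exact hve.trans (by gcongr)
      _ = _ := by rw [hN2]; ring
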